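/- arXiv:1001.5000 — 2 statements merged into one kernel-verified Lean document; each statement's English description precedes it below -/
import Mathlib

section
/- Let (A, μ, Δ, r) be a coboundary infinitesimal bialgebra, i.e., an infinitesimal bialgebra with r = Σ uᵢ⊗vᵢ ∈ A⊗A such that Δ(a) = Σ (a·uᵢ)⊗vᵢ − uᵢ⊗(vᵢ·a) for all a ∈ A. Let α : A → A be an associative algebra morphism with (α⊗α)(r) = r. Then A_α = (A, μ_α, Δ_α, α, r) is a coboundary infinitesimal Hom-bialgebra, where μ_α = α∘μ and Δ_α = Δ∘α. -/
open TensorProduct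

noncomputable section

variable {k : Type*} [Field k] {A : Type*} [AddCommGroup A] [Module k A]

/-- `(A, μ, α)` is a Hom-associative algebra: multiplicativity and Hom-associativity. -/
def IsHomAssociative (μ : A ⊗[k] A →ₗ[k] A) (α : A →ₗ[k] A) : Prop :=
  (∀ x y : A, α (μ (x ⊗ₜ y)) = μ (α x ⊗ₜ α y)) ∧
  (∀ x y z : A, μ (α x ⊗ₜ μ (y ⊗ₜ z)) = μ (μ (x ⊗ₜ y) ⊗ₜ α z))

/-- `(A, Δ, α)` is a Hom-coassociative coalgebra: comultiplicativity and
Hom-coassociativity (the latter via the associator). -/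
def IsHomCoassociative (Δ : A →ₗ[k] A ⊗[k] A) (α : A →ₗ[k] A) : Prop :=
  (∀ a : A, Δ (α a) = TensorProduct.map α α (Δ a)) ∧
  (∀ a : A, TensorProduct.map α Δ (Δ a)
      = TensorProduct.assoc k A A A (TensorProduct.map Δ α (Δ a)))

/-- The cocycle condition `Δ∘μ = (μ⊗α)∘(α⊗Δ) + (α⊗μ)∘(Δ⊗α)`. -/
def IsCocycle (μ : A ⊗[k] A →ₗ[k] A) (Δ : A →ₗ[k] A ⊗[k] A) (α : A →ₗ[k] A) : Prop :=
  ∀ a b : A,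
    Δ (μ (a ⊗ₜ b)) =
      TensorProduct.map μ α ((TensorProduct.assoc k A A A).symm (α a ⊗ₜ Δ b)) +
      TensorProduct.map α μ (TensorProduct.assoc k A A A (Δ a ⊗ₜ α b))

/-- Infinitesimal Hom-bialgebra. -/
def IsInfHomBialgebra (μ : A ⊗[k] A →ₗ[k] A) (Δ : A →ₗ[k] A ⊗[k] A)
    (α : A →ₗ[k] A) : Prop :=
  IsHomAssociative μ α ∧ IsHomCoassociative Δ α ∧ IsCocycle μ Δ α

/-- `[a, -]_*` : sends `Σ b₁⊗b₂` to `Σ μ(a,b₁)⊗α(b₂) − α(b₁)⊗μ(b₂,a)`. -/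
def starBracket (μ : A ⊗[k] A →ₗ[k] A) (α : A →ₗ[k] A) (a : A) :
    A ⊗[k] A →ₗ[k] A ⊗[k] A :=
  TensorProduct.map (μ ∘ₗ TensorProduct.mk k A A a) α
    - TensorProduct.map α (μ ∘ₗ (TensorProduct.mk k A A).flip a)

/-- Coboundary infinitesimal Hom-bialgebra: an infinitesimal Hom-bialgebra with an
`α`-invariant `r` such that `Δ = [-, r]_*`. -/
def IsCoboundary (μ : A ⊗[k] A →ₗ[k] A) (Δ : A →ₗ[k] A ⊗[k] A) (α : A →ₗ[k] A)
    (r : A ⊗[k] A) : Prop :=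
  IsInfHomBialgebra μ Δ α ∧ TensorProduct.map α α r = r ∧
    ∀ a : A, Δ a = starBracket μ α a r

/-- `[a, -]_•` on 2-tensors: `Σ μ(α(a),b₁)⊗α(b₂) − α(b₁)⊗μ(b₂,α(a))`. -/
def dotBracket2 (μ : A ⊗[k] A →ₗ[k] A) (α : A →ₗ[k] A) (a : A) :
    A ⊗[k] A →ₗ[k] A ⊗[k] A :=
  TensorProduct.map (μ ∘ₗ TensorProduct.mk k A A (α a)) α
    - TensorProduct.map α (μ ∘ₗ (TensorProduct.mk k A A).flip (α a))

/-- `[a, -]_•` on 3-tensors: `Σ μ(α(a),b₁)⊗α(b₂)⊗α(b₃) − α(b₁)⊗α(b₂)⊗μ(b₃,α(a))`. -/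
def dotBracket3 (μ : A ⊗[k] A →ₗ[k] A) (α : A →ₗ[k] A) (a : A) :
    A ⊗[k] (A ⊗[k] A) →ₗ[k] A ⊗[k] (A ⊗[k] A) :=
  TensorProduct.map (μ ∘ₗ TensorProduct.mk k A A (α a)) (TensorProduct.map α α)
    - TensorProduct.map α
        (TensorProduct.map α (μ ∘ₗ (TensorProduct.mk k A A).flip (α a)))

/-- `(r, s) ↦ r₁₃s₁₂ = Σ μ(uᵢ,uⱼ')⊗α(vⱼ')⊗α(vᵢ)` for `r = Σ uᵢ⊗vᵢ`, `s = Σ uⱼ'⊗vⱼ'`. -/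
def t13_12 (μ : A ⊗[k] A →ₗ[k] A) (α : A →ₗ[k] A) :
    (A ⊗[k] A) ⊗[k] (A ⊗[k] A) →ₗ[k] A ⊗[k] (A ⊗[k] A) :=
  TensorProduct.map μ
      (TensorProduct.map α α ∘ₗ (TensorProduct.comm k A A).toLinearMap)
    ∘ₗ (TensorProduct.tensorTensorTensorComm k A A A A).toLinearMap

/-- `(r, s) ↦ r₁₂s₂₃ = Σ α(uᵢ)⊗μ(vᵢ,uⱼ')⊗α(vⱼ')`. -/
def t12_23 (μ : A ⊗[k] A →ₗ[k] A) (α : A →ₗ[k] A) :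
    (A ⊗[k] A) ⊗[k] (A ⊗[k] A) →ₗ[k] A ⊗[k] (A ⊗[k] A) :=
  TensorProduct.map α
      (TensorProduct.map μ α ∘ₗ (TensorProduct.assoc k A A A).symm.toLinearMap)
    ∘ₗ (TensorProduct.assoc k A A (A ⊗[k] A)).toLinearMap

/-- `(r, s) ↦ r₂₃s₁₃ = Σ α(uⱼ')⊗α(uᵢ)⊗μ(vᵢ,vⱼ')`. -/
def t23_13 (μ : A ⊗[k] A →ₗ[k] A) (α : A →ₗ[k] A) :
    (A ⊗[k] A) ⊗[k] (A ⊗[k] A) →ₗ[k] A ⊗[k] (A ⊗[k] A) :=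
  (TensorProduct.assoc k A A A).toLinearMap
    ∘ₗ TensorProduct.map
        (TensorProduct.map α α ∘ₗ (TensorProduct.comm k A A).toLinearMap) μ
    ∘ₗ (TensorProduct.tensorTensorTensorComm k A A A A).toLinearMap

/-- `A(r) = r₁₃r₁₂ − r₁₂r₂₃ + r₂₃r₁₃`. -/
def Atensor (μ : A ⊗[k] A →ₗ[k] A) (α : A →ₗ[k] A) (r : A ⊗[k] A) :
    A ⊗[k] (A ⊗[k] A) :=
  t13_12 μ α (r ⊗ₜ r) - t12_23 μ α (r ⊗ₜ r) + t23_13 μ α (r ⊗ₜ r)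

/-- Quasi-triangular infinitesimal Hom-bialgebra: coboundary with `A(r) = 0`. -/
def IsQuasiTriangular (μ : A ⊗[k] A →ₗ[k] A) (Δ : A →ₗ[k] A ⊗[k] A) (α : A →ₗ[k] A)
    (r : A ⊗[k] A) : Prop :=
  IsCoboundary μ Δ α r ∧ Atensor μ α r = 0

/-- The balanceator `B(x,y) = [x, Δᵒᵖ(y)]_• + τ([y, Δᵒᵖ(x)]_•)`. -/
def balanceator (μ : A ⊗[k] A →ₗ[k] A) (Δ : A →ₗ[k] A ⊗[k] A) (α : A →ₗ[k] A)
    (x y : A) : A ⊗[k] A :=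
  dotBracket2 μ α x (TensorProduct.comm k A A (Δ y))
    + TensorProduct.comm k A A (dotBracket2 μ α y (TensorProduct.comm k A A (Δ x)))

/-- `ad_x` on 2-tensors, for a bilinear bracket `br`:
`y₁⊗y₂ ↦ [x,y₁]⊗α(y₂) + α(y₁)⊗[x,y₂]`. -/
def adMap (br : A →ₗ[k] A →ₗ[k] A) (α : A →ₗ[k] A) (x : A) :
    A ⊗[k] A →ₗ[k] A ⊗[k] A :=
  TensorProduct.map (br x) α + TensorProduct.map α (br x)

/-- Cyclic rotation on triple tensors: `x⊗y⊗z ↦ y⊗z⊗x`. -/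
def cyc3 : A ⊗[k] (A ⊗[k] A) →ₗ[k] A ⊗[k] (A ⊗[k] A) :=
  (TensorProduct.assoc k A A A).toLinearMap
    ∘ₗ (TensorProduct.comm k A (A ⊗[k] A)).toLinearMap

/-- Hom-Lie bialgebra: Hom-Lie algebra, Hom-Lie coalgebra, and the cocycle
compatibility `δ([x,y]) = ad_{α(x)}(δ(y)) − ad_{α(y)}(δ(x))`. -/
def IsHomLieBialgebra (br : A →ₗ[k] A →ₗ[k] A) (δ : A →ₗ[k] A ⊗[k] A)
    (α : A →ₗ[k] A) : Prop :=
  (∀ x y : A, br x y = - br y x) ∧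
  (∀ x y : A, α (br x y) = br (α x) (α y)) ∧
  (∀ x y z : A, br (br x y) (α z) + br (br z x) (α y) + br (br y z) (α x) = 0) ∧
  (∀ x : A, δ (α x) = TensorProduct.map α α (δ x)) ∧
  (∀ x : A, TensorProduct.comm k A A (δ x) = - δ x) ∧
  (∀ x : A, TensorProduct.map α δ (δ x) + cyc3 (TensorProduct.map α δ (δ x))
      + cyc3 (cyc3 (TensorProduct.map α δ (δ x))) = 0) ∧
  (∀ x y : A, δ (br x y) = adMap br α (α x) (δ y) - adMap br α (α y) (δ x))

/-- The commutator bracket of `μ`, as a bilinear map. -/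
def commBracket (μ : A ⊗[k] A →ₗ[k] A) : A →ₗ[k] A →ₗ[k] A :=
  TensorProduct.curry μ - (TensorProduct.curry μ).flip

/-- The cocommutator cobracket `(Id − τ)∘Δ`. -/
def cobracket (Δ : A →ₗ[k] A ⊗[k] A) : A →ₗ[k] A ⊗[k] A :=
  Δ - (TensorProduct.comm k A A).toLinearMap ∘ₗ Δ

/-- `(r, s) ↦ [r₁₂, s₁₃] = Σ β(uᵢ⊗uⱼ')⊗α(vᵢ)⊗α(vⱼ')` for a bracket `β`. -/
def c12_13 (β : A ⊗[k] A →ₗ[k] A) (α : A →ₗ[k] A) :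
    (A ⊗[k] A) ⊗[k] (A ⊗[k] A) →ₗ[k] A ⊗[k] (A ⊗[k] A) :=
  TensorProduct.map β (TensorProduct.map α α)
    ∘ₗ (TensorProduct.tensorTensorTensorComm k A A A A).toLinearMap

/-- `(r, s) ↦ [r₁₂, s₂₃] = Σ α(uᵢ)⊗β(vᵢ⊗uⱼ')⊗α(vⱼ')`. -/
def c12_23 (β : A ⊗[k] A →ₗ[k] A) (α : A →ₗ[k] A) :
    (A ⊗[k] A) ⊗[k] (A ⊗[k] A) →ₗ[k] A ⊗[k] (A ⊗[k] A) :=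
  TensorProduct.map α
      (TensorProduct.map β α ∘ₗ (TensorProduct.assoc k A A A).symm.toLinearMap)
    ∘ₗ (TensorProduct.assoc k A A (A ⊗[k] A)).toLinearMap

/-- `(r, s) ↦ [r₁₃, s₂₃] = Σ α(uᵢ)⊗α(uⱼ')⊗β(vᵢ⊗vⱼ')`. -/
def c13_23 (β : A ⊗[k] A →ₗ[k] A) (α : A →ₗ[k] A) :
    (A ⊗[k] A) ⊗[k] (A ⊗[k] A) →ₗ[k] A ⊗[k] (A ⊗[k] A) :=
  (TensorProduct.assoc k A A A).toLinearMap
    ∘ₗ TensorProduct.map (TensorProduct.map α α) β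
    ∘ₗ (TensorProduct.tensorTensorTensorComm k A A A A).toLinearMap

/-- `C(r) = [r₁₂,r₁₃] + [r₁₂,r₂₃] + [r₁₃,r₂₃]` for a bracket `β`. -/
def Ctensor (β : A ⊗[k] A →ₗ[k] A) (α : A →ₗ[k] A) (r : A ⊗[k] A) :
    A ⊗[k] (A ⊗[k] A) :=
  c12_13 β α (r ⊗ₜ r) + c12_23 β α (r ⊗ₜ r) + c13_23 β α (r ⊗ₜ r)

/-- Twisting the multiplication by a linear map `α` pushes the bracket forward along `α ⊗ α`. -/
theorem starBracket_comp (μ : A ⊗[k] A →ₗ[k] A) (α : A →ₗ[k] A) (a : A) (t : A ⊗[k] A) :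
    starBracket (α ∘ₗ μ) α a t =
      TensorProduct.map α α (starBracket μ (LinearMap.id : A →ₗ[k] A) a t) := by
  induction t using TensorProduct.induction_on with
  | zero => simp
  | tmul x y => simp [starBracket]
  | add x y hx hy => rw [map_add, hx, hy, map_add, map_add]

/-- The bracket is natural with respect to multiplicative linear maps. -/
theorem map_starBracket {μ : A ⊗[k] A →ₗ[k] A} {α : A →ₗ[k] A}
    (hα : ∀ x y : A, α (μ (x ⊗ₜ y)) = μ (α x ⊗ₜ α y)) (a : A) (t : A ⊗[k] A) :
    TensorProduct.map α α (starBracket μ (LinearMap.id : A →ₗ[k] A) a t) =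
      starBracket μ (LinearMap.id : A →ₗ[k] A) (α a) (TensorProduct.map α α t) := by
  induction t using TensorProduct.induction_on with
  | zero => simp
  | tmul x y => simp [starBracket, hα]
  | add x y hx hy => simp only [map_add, hx, hy]

/-- Twisting an associative multiplication by a multiplicative map is Hom-associative. -/
theorem IsHomAssociative.twist {μ : A ⊗[k] A →ₗ[k] A} {α : A →ₗ[k] A}
    (h : IsHomAssociative μ (LinearMap.id : A →ₗ[k] A))
    (hα : ∀ x y : A, α (μ (x ⊗ₜ y)) = μ (α x ⊗ₜ α y)) :
    IsHomAssociative (α ∘ₗ μ) α := by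
  have hassoc : ∀ x y z : A, μ (x ⊗ₜ μ (y ⊗ₜ z)) = μ (μ (x ⊗ₜ y) ⊗ₜ z) := h.2
  exact ⟨fun x y => by simp [hα], fun x y z => by simp [hα, hassoc]⟩

/-- Twisting a coassociative comultiplication by a comultiplicative map is
Hom-coassociative. -/
theorem IsHomCoassociative.twist {Δ : A →ₗ[k] A ⊗[k] A} {α : A →ₗ[k] A}
    (h : IsHomCoassociative Δ (LinearMap.id : A →ₗ[k] A))
    (hα : ∀ a : A, Δ (α a) = TensorProduct.map α α (Δ a)) :
    IsHomCoassociative (Δ ∘ₗ α) α := by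
  have hcomp : Δ ∘ₗ α = TensorProduct.map α α ∘ₗ Δ := LinearMap.ext hα
  refine ⟨fun a => hα (α a), fun a => ?_⟩
  have hl (t : A ⊗[k] A) : TensorProduct.map α (Δ ∘ₗ α) t =
      TensorProduct.map α (TensorProduct.map α α) (TensorProduct.map LinearMap.id Δ t) := by
    rw [hcomp, TensorProduct.map_map, LinearMap.comp_id]
  have hr (t : A ⊗[k] A) : TensorProduct.map (Δ ∘ₗ α) α t =
      TensorProduct.map (TensorProduct.map α α) α (TensorProduct.map Δ LinearMap.id t) := by
    rw [hcomp, TensorProduct.map_map, LinearMap.comp_id]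
  rw [hl, hr, LinearMap.comp_apply, h.2, TensorProduct.map_map_assoc]

/-- Twisting both structure maps of a cocycle by a comultiplicative map gives a cocycle. -/
theorem IsCocycle.twist {μ : A ⊗[k] A →ₗ[k] A} {Δ : A →ₗ[k] A ⊗[k] A} {α : A →ₗ[k] A}
    (h : IsCocycle μ Δ (LinearMap.id : A →ₗ[k] A))
    (hμ : ∀ x y : A, α (μ (x ⊗ₜ y)) = μ (α x ⊗ₜ α y))
    (hα : ∀ a : A, Δ (α a) = TensorProduct.map α α (Δ a)) :
    IsCocycle (α ∘ₗ μ) (Δ ∘ₗ α) α := by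
  intro a b
  have hl (t : (A ⊗[k] A) ⊗[k] A) : TensorProduct.map (α ∘ₗ μ) α t =
      TensorProduct.map α α (TensorProduct.map μ LinearMap.id t) := by
    rw [TensorProduct.map_map, LinearMap.comp_id]
  have hr (t : A ⊗[k] (A ⊗[k] A)) : TensorProduct.map α (α ∘ₗ μ) t =
      TensorProduct.map α α (TensorProduct.map LinearMap.id μ t) := by
    rw [TensorProduct.map_map, LinearMap.comp_id]
  have hab := h (α a) (α b)
  simp only [LinearMap.id_apply] at hab
  rw [LinearMap.comp_apply, LinearMap.comp_apply, hα, hμ, hab, map_add, hl, hr,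
    LinearMap.comp_apply, LinearMap.comp_apply]

/-- twisting a coboundary infinitesimal bialgebra along an algebra
morphism fixing `r` yields a coboundary infinitesimal Hom-bialgebra. -/
theorem stmt5 [CharZero k]
    (μ : A ⊗[k] A →ₗ[k] A) (Δ : A →ₗ[k] A ⊗[k] A) (r : A ⊗[k] A)
    (h : IsInfHomBialgebra μ Δ (LinearMap.id : A →ₗ[k] A))
    (hΔ : ∀ a : A, Δ a = starBracket μ (LinearMap.id : A →ₗ[k] A) a r)
    (α : A →ₗ[k] A)
    (hαμ : ∀ x y : A, α (μ (x ⊗ₜ y)) = μ (α x ⊗ₜ α y))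
    (hr : TensorProduct.map α α r = r) :
    IsCoboundary (α ∘ₗ μ) (Δ ∘ₗ α) α r := by
  have hcomul (a : A) : Δ (α a) = TensorProduct.map α α (Δ a) := by
    rw [hΔ, hΔ, map_starBracket hαμ, hr]
  refine ⟨⟨h.1.twist hαμ, h.2.1.twist hcomul, h.2.2.twist hαμ hcomul⟩, hr, fun a => ?_⟩
  rw [starBracket_comp, ← hΔ, ← hcomul, LinearMap.comp_apply]

end
end

section
/- Let (A, μ, Δ, α) be an infinitesimal Hom-bialgebra and let r = Σ uᵢ⊗vᵢ ∈ A⊗A be an α-invariant 2-tensor. Define the perturbed comultiplication Δ' = Δ + [−,r]_* : A → A⊗A. Then (A, μ, Δ', α) is an infinitesimal Hom-bialgebra if and only if for every a ∈ A, [a, (α⊗Δ)(r) − (Δ⊗α)(r) − A(r)]_• = r₂₃Δ(a)₁₃ + Δ(a)₁₃r₁₂, where, writing Δ(a) = Σ a₁⊗a₂, r₂₃Δ(a)₁₃ = Σ α(a₁)⊗α(uᵢ)⊗μ(vᵢ,a₂) and Δ(a)₁₃r₁₂ = Σ μ(a₁,uᵢ)⊗α(vᵢ)⊗α(a₂). 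-/
open TensorProduct

noncomputable section

variable {k : Type*} [Field k] {A : Type*} [AddCommGroup A] [Module k A]

@[simp]
theorem starBracket_tmul (μ : A ⊗[k] A →ₗ[k] A) (α : A →ₗ[k] A) (a u v : A) :
    starBracket μ α a (u ⊗ₜ v) = μ (a ⊗ₜ u) ⊗ₜ α v - α u ⊗ₜ μ (v ⊗ₜ a) := by
  simp [starBracket]

@[simp]
theorem dotBracket3_tmul (μ : A ⊗[k] A →ₗ[k] A) (α : A →ₗ[k] A) (a u v w : A) :
    dotBracket3 μ α a (u ⊗ₜ (v ⊗ₜ w)) =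
      μ (α a ⊗ₜ u) ⊗ₜ (α v ⊗ₜ α w) - α u ⊗ₜ (α v ⊗ₜ μ (w ⊗ₜ α a)) := by
  simp [dotBracket3]

@[simp]
theorem t13_12_tmul (μ : A ⊗[k] A →ₗ[k] A) (α : A →ₗ[k] A) (u v u' v' : A) :
    t13_12 μ α ((u ⊗ₜ v) ⊗ₜ (u' ⊗ₜ v')) = μ (u ⊗ₜ u') ⊗ₜ (α v' ⊗ₜ α v) := by
  simp [t13_12]

@[simp]
theorem t12_23_tmul (μ : A ⊗[k] A →ₗ[k] A) (α : A →ₗ[k] A) (u v u' v' : A) :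
    t12_23 μ α ((u ⊗ₜ v) ⊗ₜ (u' ⊗ₜ v')) = α u ⊗ₜ (μ (v ⊗ₜ u') ⊗ₜ α v') := by
  simp [t12_23]

@[simp]
theorem t23_13_tmul (μ : A ⊗[k] A →ₗ[k] A) (α : A →ₗ[k] A) (u v u' v' : A) :
    t23_13 μ α ((u ⊗ₜ v) ⊗ₜ (u' ⊗ₜ v')) = α u' ⊗ₜ (α u ⊗ₜ μ (v ⊗ₜ v')) := by
  simp [t23_13]

/-- The bracket `[-, r]_*` as a linear map. -/
def starMap (μ : A ⊗[k] A →ₗ[k] A) (α : A →ₗ[k] A) :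
    A ⊗[k] A →ₗ[k] A →ₗ[k] A ⊗[k] A :=
  LinearMap.flip
    { toFun := starBracket μ α
      map_add' := fun a b => by
        ext u v
        simp [add_tmul, tmul_add]
        abel
      map_smul' := fun c a => by
        ext u v
        simp [← smul_tmul', smul_sub] }

@[simp]
theorem starMap_apply (μ : A ⊗[k] A →ₗ[k] A) (α : A →ₗ[k] A) (r : A ⊗[k] A) (a : A) :
    starMap μ α r a = starBracket μ α a r :=
  rfl

/-- Comultiplicativity of `[-, r]_*`, up to applying `α ⊗ α` to `r`. -/
theorem starBracket_map_map {μ : A ⊗[k] A →ₗ[k] A} {α : A →ₗ[k] A}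
    (h : IsHomAssociative μ α) (a : A) (r : A ⊗[k] A) :
    starBracket μ α (α a) (TensorProduct.map α α r) =
      TensorProduct.map α α (starBracket μ α a r) := by
  induction r with
  | zero => simp
  | add x y hx hy => simp only [map_add, hx, hy]
  | tmul u v => simp [h.1]

/-- The cocycle condition for `[-, r]_*`, up to applying `α ⊗ α` to `r`. -/
theorem starBracket_mul {μ : A ⊗[k] A →ₗ[k] A} {α : A →ₗ[k] A}
    (h : IsHomAssociative μ α) (a b : A) (r : A ⊗[k] A) :
    starBracket μ α (μ (a ⊗ₜ b)) (TensorProduct.map α α r) =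
      TensorProduct.map μ α
          ((TensorProduct.assoc k A A A).symm (α a ⊗ₜ starBracket μ α b r)) +
        TensorProduct.map α μ
          (TensorProduct.assoc k A A A (starBracket μ α a r ⊗ₜ α b)) := by
  induction r with
  | zero => simp
  | add x y hx hy =>
    simp only [map_add, hx, hy, tmul_add, add_tmul]
    abel
  | tmul u v => simp [h.1, ← h.2, tmul_sub, sub_tmul]

/-- The failure of Hom-coassociativity of `[-, r]_*`, polarized in `r`. -/
theorem starBracket_starBracket {μ : A ⊗[k] A →ₗ[k] A} {α : A →ₗ[k] A}
    (h : IsHomAssociative μ α) (a : A) (r s : A ⊗[k] A) :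
    TensorProduct.map α (starMap μ α (TensorProduct.map α α s)) (starBracket μ α a r) -
        TensorProduct.assoc k A A A
          (TensorProduct.map (starMap μ α (TensorProduct.map α α r)) α
            (starBracket μ α a s)) =
      -dotBracket3 μ α a
        (t13_12 μ α (s ⊗ₜ r) - t12_23 μ α (r ⊗ₜ s) + t23_13 μ α (s ⊗ₜ r)) := by
  induction r with
  | zero => simp
  | add x y hx hy =>
    simp only [map_add, map_sub, tmul_add, add_tmul, map_add_left, LinearMap.add_apply] at hx hy ⊢
    linear_combination (norm := abel) hx + hy
  | tmul u v =>
    induction s with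
    | zero => simp
    | add x y hx hy =>
      simp only [map_add, map_sub, tmul_add, add_tmul, map_add_right,
        LinearMap.add_apply] at hx hy ⊢
      linear_combination (norm := abel) hx + hy
    | tmul u' v' =>
      simp [h.1, h.2, tmul_sub, sub_tmul]
      abel

theorem map_starMap_sub (μ : A ⊗[k] A →ₗ[k] A) (α : A →ₗ[k] A) (r b : A ⊗[k] A) :
    TensorProduct.map α (starMap μ α r) b -
        TensorProduct.assoc k A A A (TensorProduct.map (starMap μ α r) α b) =
      t12_23 μ α (b ⊗ₜ r) + t12_23 μ α (r ⊗ₜ b) -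
        (t23_13 μ α (r ⊗ₜ b) + t13_12 μ α (b ⊗ₜ r)) := by
  induction r with
  | zero => simp
  | add x y hx hy =>
    simp only [map_add, tmul_add, add_tmul, map_add_left, map_add_right,
      LinearMap.add_apply] at hx hy ⊢
    linear_combination (norm := abel) hx + hy
  | tmul u v =>
    induction b with
    | zero => simp
    | add x y hx hy =>
      simp only [map_add, tmul_add, add_tmul] at hx hy ⊢
      linear_combination (norm := abel) hx + hy
    | tmul b₁ b₂ =>
      simp [tmul_sub, sub_tmul]
      abel

theorem map_comul_starBracket {μ : A ⊗[k] A →ₗ[k] A} {Δ : A →ₗ[k] A ⊗[k] A}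
    {α : A →ₗ[k] A} (h : IsInfHomBialgebra μ Δ α) (a : A) (r : A ⊗[k] A) :
    TensorProduct.map α Δ (starBracket μ α a r) =
      dotBracket3 μ α a (TensorProduct.map α Δ r) -
        t12_23 μ α (TensorProduct.map α α r ⊗ₜ Δ a) := by
  induction r with
  | zero => simp
  | add x y hx hy =>
    simp only [map_add, add_tmul, hx, hy]
    abel
  | tmul u v =>
    simp only [starBracket_tmul, map_sub, map_tmul, h.1.1, h.2.1.1, h.2.2 v a]
    generalize Δ v = p
    generalize Δ a = q
    have hp : μ (α a ⊗ₜ α u) ⊗ₜ TensorProduct.map α α p -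
        α (α u) ⊗ₜ TensorProduct.map α μ (TensorProduct.assoc k A A A (p ⊗ₜ α a)) =
        dotBracket3 μ α a (α u ⊗ₜ p) := by
      induction p with
      | zero => simp
      | add x y hx hy =>
        simp only [map_add, tmul_add, add_tmul, ← hx, ← hy]
        abel
      | tmul => simp
    have hq : α (α u) ⊗ₜ
        TensorProduct.map μ α ((TensorProduct.assoc k A A A).symm (α v ⊗ₜ q)) =
        t12_23 μ α ((α u ⊗ₜ α v) ⊗ₜ q) := by
      induction q with
      | zero => simp
      | add x y hx hy => simp only [map_add, tmul_add, ← hx, ← hy]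
      | tmul => simp
    rw [← hp, ← hq, tmul_add]
    abel

theorem map_starBracket_comul {μ : A ⊗[k] A →ₗ[k] A} {Δ : A →ₗ[k] A ⊗[k] A}
    {α : A →ₗ[k] A} (h : IsInfHomBialgebra μ Δ α) (a : A) (r : A ⊗[k] A) :
    TensorProduct.assoc k A A A (TensorProduct.map Δ α (starBracket μ α a r)) =
      dotBracket3 μ α a (TensorProduct.assoc k A A A (TensorProduct.map Δ α r)) +
        t12_23 μ α (Δ a ⊗ₜ TensorProduct.map α α r) := by
  induction r with
  | zero => simp
  | add x y hx hy =>
    simp only [map_add, tmul_add, hx, hy]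
    abel
  | tmul u v =>
    simp only [starBracket_tmul, map_sub, map_tmul, h.1.1, h.2.1.1, h.2.2 a u]
    generalize Δ u = p
    generalize Δ a = q
    have hp : TensorProduct.assoc k A A A
          (TensorProduct.map μ α ((TensorProduct.assoc k A A A).symm (α a ⊗ₜ p)) ⊗ₜ α (α v)) -
        TensorProduct.assoc k A A A (TensorProduct.map α α p ⊗ₜ μ (α v ⊗ₜ α a)) =
        dotBracket3 μ α a (TensorProduct.assoc k A A A (p ⊗ₜ α v)) := by
      induction p with
      | zero => simp
      | add x y hx hy =>
        simp only [map_add, tmul_add, add_tmul, ← hx, ← hy]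
        abel
      | tmul => simp
    have hq : TensorProduct.assoc k A A A
          (TensorProduct.map α μ (TensorProduct.assoc k A A A (q ⊗ₜ α u)) ⊗ₜ α (α v)) =
        t12_23 μ α (q ⊗ₜ (α u ⊗ₜ α v)) := by
      induction q with
      | zero => simp
      | add x y hx hy => simp only [map_add, add_tmul, ← hx, ← hy]
      | tmul => simp
    rw [← hp, ← hq, add_tmul, map_add]
    abel

/-- The failure of Hom-coassociativity of the perturbed comultiplication. -/
theorem perturbation_coassociator {μ : A ⊗[k] A →ₗ[k] A} {Δ : A →ₗ[k] A ⊗[k] A}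
    {α : A →ₗ[k] A} (h : IsInfHomBialgebra μ Δ α) {r : A ⊗[k] A}
    (hr : TensorProduct.map α α r = r) (a : A) :
    TensorProduct.map α (Δ + starMap μ α r) ((Δ + starMap μ α r) a) -
        TensorProduct.assoc k A A A
          (TensorProduct.map (Δ + starMap μ α r) α ((Δ + starMap μ α r) a)) =
      dotBracket3 μ α a
          (TensorProduct.map α Δ r
            - TensorProduct.assoc k A A A (TensorProduct.map Δ α r) - Atensor μ α r) -
        (t23_13 μ α (r ⊗ₜ Δ a) + t13_12 μ α (Δ a ⊗ₜ r)) := by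
  have h₁ := starBracket_starBracket h.1 a r r
  have h₂ := map_starMap_sub μ α r (Δ a)
  have h₃ := map_comul_starBracket h a r
  have h₄ := map_starBracket_comul h a r
  rw [hr] at h₁ h₃ h₄
  simp only [map_add_left, map_add_right, LinearMap.add_apply, map_add, map_sub, Atensor,
    starMap_apply] at h₁ h₂ h₃ h₄ ⊢
  linear_combination (norm := abel) h₁ + h₂ + h₃ - h₄ + h.2.1.2 a

/-- perturbation of the comultiplication. `(A, μ, Δ + [−,r]_*, α)` is an
infinitesimal Hom-bialgebra iff
`[a, (α⊗Δ)(r) − (Δ⊗α)(r) − A(r)]_• = r₂₃Δ(a)₁₃ + Δ(a)₁₃r₁₂` for all `a`. -/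
theorem stmt10 [CharZero k]
    (μ : A ⊗[k] A →ₗ[k] A) (Δ : A →ₗ[k] A ⊗[k] A) (α : A →ₗ[k] A)
    (h : IsInfHomBialgebra μ Δ α)
    (r : A ⊗[k] A) (hr : TensorProduct.map α α r = r)
    (Δ' : A →ₗ[k] A ⊗[k] A)
    (hΔ' : ∀ a : A, Δ' a = Δ a + starBracket μ α a r) :
    IsInfHomBialgebra μ Δ' α ↔
      ∀ a : A,
        dotBracket3 μ α a
            (TensorProduct.map α Δ r
              - TensorProduct.assoc k A A A (TensorProduct.map Δ α r)
              - Atensor μ α r)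
          = t23_13 μ α (r ⊗ₜ Δ a) + t13_12 μ α (Δ a ⊗ₜ r) := by
  obtain rfl : Δ' = Δ + starMap μ α r := LinearMap.ext hΔ'
  have coassoc := perturbation_coassociator h hr
  constructor
  · rintro ⟨-, ⟨-, h'⟩, -⟩ a
    rw [← sub_eq_zero, ← coassoc a, h' a, sub_self]
  · intro h'
    refine ⟨h.1, ⟨fun a => ?_, fun a => ?_⟩, fun a b => ?_⟩
    · have := starBracket_map_map h.1 a r
      rw [hr] at this
      simp [h.2.1.1, this]
    · rw [← sub_eq_zero, coassoc a, h' a, sub_self]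
    · have := starBracket_mul h.1 a b r
      rw [hr] at this
      simp only [LinearMap.add_apply, starMap_apply, h.2.2 a b, this, tmul_add, add_tmul, map_add]
      abel

end
end
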